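/- arXiv:2301.02177 — 2 statements merged into one kernel-verified Lean document; each statement's English description precedes it below -/
import Mathlib

section
/- For any vertex-weighted graph (G, ω), the vertex-weighted Kromatic symmetric function expands positively in the K-theoretic augmented monomial symmetric functions as \overline{X}_{(G,ω)} = Σ_{C ∈ SSC(G)} \overline{\widetilde{m}}_{λ(C)}, where the sum is over all stable set covers C of G. -/
open scoped Classical

noncomputable section

/-- A proper set coloring assigns to each vertex a nonempty finite set of colors
(positive integers, here indexed by `ℕ`) such that adjacent vertices get disjoint sets. -/
def IsProperSetColoring {V : Type*} (G : SimpleGraph V) (κ : V → Finset ℕ) : Prop :=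
  (∀ v, (κ v).Nonempty) ∧ ∀ ⦃u v : V⦄, G.Adj u v → Disjoint (κ u) (κ v)

/-- The exponent vector of the monomial `∏_v (∏_{i ∈ κ v} x_i)^(ω v)`. -/
def setColWeight {V : Type*} [Fintype V] (ω : V → ℕ) (κ : V → Finset ℕ) : ℕ →₀ ℕ :=
  ∑ v : V, ω v • (κ v).sum (fun i => Finsupp.single i 1)

/-- The (vertex-weighted) Kromatic symmetric function, as a power series in
`x_0, x_1, x_2, …`: the coefficient of a monomial is the number of proper set
colorings producing that monomial. -/
def kromatic {V : Type*} [Fintype V] (G : SimpleGraph V) (ω : V → ℕ) :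
    MvPowerSeries ℕ ℤ :=
  fun d => (Nat.card {κ : V → Finset ℕ //
    IsProperSetColoring G κ ∧ setColWeight ω κ = d} : ℤ)

/-- A stable set cover of `G`: a collection of distinct nonempty stable sets whose
union is the whole vertex set. -/
def IsStableSetCover {V : Type*} (G : SimpleGraph V) (C : Finset (Finset V)) : Prop :=
  (∀ S ∈ C, S.Nonempty ∧ ∀ a ∈ S, ∀ b ∈ S, ¬ G.Adj a b) ∧
  ∀ v : V, ∃ S ∈ C, v ∈ S

/-- The set of vertices receiving the color `i`. -/
def colorClass {V : Type*} [Fintype V] (κ : V → Finset ℕ) (i : ℕ) : Finset V :=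
  Finset.univ.filter (fun v => i ∈ κ v)

/-- The collection of the color classes of all the colors used by `κ`. -/
def colorClasses {V : Type*} [Fintype V] (κ : V → Finset ℕ) : Finset (Finset V) :=
  (Finset.univ.biUnion κ).image (colorClass κ)

/-- The set coloring of `V` giving to `v` all the colors of the members of `C` containing `v`. -/
def vertexColoring {V : Type*} (C : Finset (Finset V))
    (κ : {S : Finset V // S ∈ C} → Finset ℕ) (v : V) : Finset ℕ :=
  (Finset.univ.filter (fun S : {S : Finset V // S ∈ C} => v ∈ S.1)).biUnion κ

/-- The set coloring of `C` giving to `S` all the colors whose color class is `S`. -/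
def coverColoring {V : Type*} [Fintype V] (C : Finset (Finset V))
    (κ : V → Finset ℕ) (S : {S : Finset V // S ∈ C}) : Finset ℕ :=
  (Finset.univ.biUnion κ).filter (fun i => colorClass κ i = S.1)

section Coloring

variable {V : Type*} {G : SimpleGraph V} {C : Finset (Finset V)}

theorem mem_vertexColoring {κ : {S : Finset V // S ∈ C} → Finset ℕ} {i : ℕ} {v : V} :
    i ∈ vertexColoring C κ v ↔ ∃ S : {S : Finset V // S ∈ C}, v ∈ S.1 ∧ i ∈ κ S := by
  simp only [vertexColoring, Finset.mem_biUnion, Finset.mem_filter, Finset.mem_univ, true_and]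

theorem eq_of_mem_of_mem {κ : {S : Finset V // S ∈ C} → Finset ℕ}
    (hκ : IsProperSetColoring ⊤ κ) {i : ℕ} {S T : {S : Finset V // S ∈ C}}
    (hS : i ∈ κ S) (hT : i ∈ κ T) : S = T := by
  by_contra h
  exact Finset.disjoint_left.1 (hκ.2 ((SimpleGraph.top_adj S T).2 h)) hS hT

theorem isProperSetColoring_vertexColoring (hC : IsStableSetCover G C)
    {κ : {S : Finset V // S ∈ C} → Finset ℕ} (hκ : IsProperSetColoring ⊤ κ) :
    IsProperSetColoring G (vertexColoring C κ) := by
  refine ⟨fun v => ?_, fun u v huv => Finset.disjoint_left.2 fun i hu hv => ?_⟩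
  · obtain ⟨S, hS, hv⟩ := hC.2 v
    obtain ⟨i, hi⟩ := hκ.1 ⟨S, hS⟩
    exact ⟨i, mem_vertexColoring.2 ⟨⟨S, hS⟩, hv, hi⟩⟩
  · obtain ⟨S, huS, hS⟩ := mem_vertexColoring.1 hu
    obtain ⟨T, hvT, hT⟩ := mem_vertexColoring.1 hv
    obtain rfl := eq_of_mem_of_mem hκ hS hT
    exact (hC.1 S.1 S.2).2 u huS v hvT huv

variable [Fintype V]

theorem mem_colorClass {κ : V → Finset ℕ} {i : ℕ} {v : V} : v ∈ colorClass κ i ↔ i ∈ κ v := by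
  simp [colorClass]

theorem mem_colorClasses {κ : V → Finset ℕ} {S : Finset V} :
    S ∈ colorClasses κ ↔ ∃ i, (∃ v, i ∈ κ v) ∧ colorClass κ i = S := by
  simp [colorClasses]

theorem mem_coverColoring {κ : V → Finset ℕ} {i : ℕ} {S : {S : Finset V // S ∈ C}} :
    i ∈ coverColoring C κ S ↔ (∃ v, i ∈ κ v) ∧ colorClass κ i = S.1 := by
  simp [coverColoring]

theorem setColWeight_apply (ω : V → ℕ) (κ : V → Finset ℕ) (i : ℕ) :
    setColWeight ω κ i = ∑ v ∈ colorClass κ i, ω v := by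
  simp [setColWeight, colorClass, Finsupp.finsetSum_apply, Finsupp.single_apply,
    Finset.sum_filter]

theorem finite_setColWeight_eq {ω : V → ℕ} (hω : ∀ v, 0 < ω v) (d : ℕ →₀ ℕ) :
    {κ : V → Finset ℕ | setColWeight ω κ = d}.Finite := by
  refine (Set.Finite.pi' (fun _ : V => d.support.powerset.finite_toSet)).subset ?_
  rintro κ rfl v
  simp only [Finset.coe_powerset, Set.mem_preimage, Set.mem_powerset_iff, Finset.coe_subset]
  intro i hi
  rw [Finsupp.mem_support_iff, setColWeight_apply]
  exact (Finset.sum_pos (fun u _ => hω u) ⟨v, mem_colorClass.2 hi⟩).ne'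

theorem colorClass_vertexColoring {κ : {S : Finset V // S ∈ C} → Finset ℕ}
    (hκ : IsProperSetColoring ⊤ κ) {i : ℕ} {S : {S : Finset V // S ∈ C}} (hS : i ∈ κ S) :
    colorClass (vertexColoring C κ) i = S.1 := by
  ext v
  rw [mem_colorClass, mem_vertexColoring]
  constructor
  · rintro ⟨T, hv, hT⟩
    rwa [eq_of_mem_of_mem hκ hS hT]
  · exact fun hv => ⟨S, hv, hS⟩

theorem colorClasses_vertexColoring (hC : IsStableSetCover G C)
    {κ : {S : Finset V // S ∈ C} → Finset ℕ} (hκ : IsProperSetColoring ⊤ κ) :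
    colorClasses (vertexColoring C κ) = C := by
  ext S
  rw [mem_colorClasses]
  constructor
  · rintro ⟨i, ⟨v, hv⟩, rfl⟩
    obtain ⟨T, -, hT⟩ := mem_vertexColoring.1 hv
    rw [colorClass_vertexColoring hκ hT]
    exact T.2
  · intro hS
    obtain ⟨i, hi⟩ := hκ.1 ⟨S, hS⟩
    obtain ⟨v, hv⟩ := (hC.1 S hS).1
    exact ⟨i, ⟨v, mem_vertexColoring.2 ⟨⟨S, hS⟩, hv, hi⟩⟩, colorClass_vertexColoring hκ hi⟩

theorem isStableSetCover_colorClasses {κ : V → Finset ℕ} (hκ : IsProperSetColoring G κ) :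
    IsStableSetCover G (colorClasses κ) := by
  refine ⟨fun S hS => ?_, fun v => ?_⟩
  · obtain ⟨i, ⟨v, hv⟩, rfl⟩ := mem_colorClasses.1 hS
    exact ⟨⟨v, mem_colorClass.2 hv⟩, fun a ha b hb hab =>
      Finset.disjoint_left.1 (hκ.2 hab) (mem_colorClass.1 ha) (mem_colorClass.1 hb)⟩
  · obtain ⟨i, hi⟩ := hκ.1 v
    exact ⟨colorClass κ i, mem_colorClasses.2 ⟨i, ⟨v, hi⟩, rfl⟩, mem_colorClass.2 hi⟩

theorem isProperSetColoring_coverColoring {κ : V → Finset ℕ} (hC : colorClasses κ = C) :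
    IsProperSetColoring ⊤ (coverColoring C κ) := by
  refine ⟨fun S => ?_, fun S T hST => Finset.disjoint_left.2 fun i hS hT => ?_⟩
  · obtain ⟨i, hi⟩ := mem_colorClasses.1 (hC.symm.subset S.2)
    exact ⟨i, mem_coverColoring.2 hi⟩
  · exact hST.ne (Subtype.ext
      ((mem_coverColoring.1 hS).2.symm.trans (mem_coverColoring.1 hT).2))

theorem vertexColoring_coverColoring {κ : V → Finset ℕ} (hC : colorClasses κ = C) :
    vertexColoring C (coverColoring C κ) = κ := by
  ext v i
  rw [mem_vertexColoring]
  constructor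
  · rintro ⟨S, hv, hi⟩
    rwa [← (mem_coverColoring.1 hi).2, mem_colorClass] at hv
  · intro hi
    exact ⟨⟨colorClass κ i, hC ▸ mem_colorClasses.2 ⟨i, ⟨v, hi⟩, rfl⟩⟩, mem_colorClass.2 hi,
      mem_coverColoring.2 ⟨⟨v, hi⟩, rfl⟩⟩

theorem coverColoring_vertexColoring (hC : IsStableSetCover G C)
    {κ : {S : Finset V // S ∈ C} → Finset ℕ} (hκ : IsProperSetColoring ⊤ κ) :
    coverColoring C (vertexColoring C κ) = κ := by
  ext S i
  rw [mem_coverColoring]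
  constructor
  · rintro ⟨⟨v, hv⟩, hi⟩
    obtain ⟨T, -, hT⟩ := mem_vertexColoring.1 hv
    rwa [← Subtype.ext ((colorClass_vertexColoring hκ hT).symm.trans hi)]
  · intro hi
    obtain ⟨v, hv⟩ := (hC.1 S.1 S.2).1
    exact ⟨⟨v, mem_vertexColoring.2 ⟨S, hv, hi⟩⟩, colorClass_vertexColoring hκ hi⟩

theorem setColWeight_vertexColoring (ω : V → ℕ)
    {κ : {S : Finset V // S ∈ C} → Finset ℕ} (hκ : IsProperSetColoring ⊤ κ) :
    setColWeight ω (vertexColoring C κ) =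
      setColWeight (fun S : {S : Finset V // S ∈ C} => ∑ v ∈ S.1, ω v) κ := by
  ext i
  rw [setColWeight_apply, setColWeight_apply]
  by_cases h : ∃ S, i ∈ κ S
  · obtain ⟨S, hS⟩ := h
    have : colorClass κ i = {S} := by
      ext T
      rw [mem_colorClass, Finset.mem_singleton]
      exact ⟨fun hT => eq_of_mem_of_mem hκ hT hS, fun hT => hT ▸ hS⟩
    rw [colorClass_vertexColoring hκ hS, this, Finset.sum_singleton]
  · have h₁ : colorClass κ i = ∅ :=
      Finset.eq_empty_of_forall_notMem fun S hS => h ⟨S, mem_colorClass.1 hS⟩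
    have h₂ : colorClass (vertexColoring C κ) i = ∅ :=
      Finset.eq_empty_of_forall_notMem fun v hv => by
        obtain ⟨S, -, hS⟩ := mem_vertexColoring.1 (mem_colorClass.1 hv)
        exact h ⟨S, hS⟩
    rw [h₁, h₂, Finset.sum_empty, Finset.sum_empty]

/-- Proper set colorings of `G` with family of color classes `C` correspond to proper set
colorings of the complete graph on `C`. -/
def fiberEquiv (ω : V → ℕ) (d : ℕ →₀ ℕ) (hC : IsStableSetCover G C) :
    {κ : {κ : V → Finset ℕ // IsProperSetColoring G κ ∧ setColWeight ω κ = d} //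
      colorClasses κ.1 = C} ≃
    {κ : {S : Finset V // S ∈ C} → Finset ℕ // IsProperSetColoring ⊤ κ ∧
      setColWeight (fun S : {S : Finset V // S ∈ C} => ∑ v ∈ S.1, ω v) κ = d} where
  toFun κ := ⟨coverColoring C κ.1.1, isProperSetColoring_coverColoring κ.2, by
    rw [← setColWeight_vertexColoring ω (isProperSetColoring_coverColoring κ.2),
      vertexColoring_coverColoring κ.2, κ.1.2.2]⟩
  invFun κ := ⟨⟨vertexColoring C κ.1, isProperSetColoring_vertexColoring hC κ.2.1, by
    rw [setColWeight_vertexColoring ω κ.2.1, κ.2.2]⟩, colorClasses_vertexColoring hC κ.2.1⟩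
  left_inv κ := Subtype.ext (Subtype.ext (vertexColoring_coverColoring κ.2))
  right_inv κ := Subtype.ext (coverColoring_vertexColoring hC κ.2.1)

end Coloring

/-- For a stable set cover `C` of a vertex-weighted graph `(G, ω)`, the K-theoretic
augmented monomial symmetric function `m̄~_{λ(C)}` is the Kromatic symmetric function of
the complete graph on the elements of `C`, where the element `S ∈ C` has weight
`∑_{v ∈ S} ω v` (these weights are the parts of the partition `λ(C)`).
The Kromatic symmetric function of `(G, ω)` is the sum of `m̄~_{λ(C)}` over all
stable set covers `C` of `G`. -/
theorem kromatic_eq_sum_stableSetCovers {V : Type*} [Fintype V]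
    (G : SimpleGraph V) (ω : V → ℕ) (hω : ∀ v, 0 < ω v) :
    kromatic G ω =
      ∑ C ∈ Finset.univ.filter (fun C : Finset (Finset V) => IsStableSetCover G C),
        kromatic (⊤ : SimpleGraph {S : Finset V // S ∈ C}) (fun S => ∑ v ∈ S.1, ω v) := by
  ext d
  rw [map_sum]
  change (Nat.card {κ : V → Finset ℕ // IsProperSetColoring G κ ∧ setColWeight ω κ = d} : ℤ) =
    ∑ C ∈ Finset.univ.filter (fun C : Finset (Finset V) => IsStableSetCover G C),
      (Nat.card {κ : {S : Finset V // S ∈ C} → Finset ℕ // IsProperSetColoring ⊤ κ ∧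
        setColWeight (fun S : {S : Finset V // S ∈ C} => ∑ v ∈ S.1, ω v) κ = d} : ℤ)
  have hfin : Finite {κ : V → Finset ℕ // IsProperSetColoring G κ ∧ setColWeight ω κ = d} :=
    ((finite_setColWeight_eq hω d).subset fun _ h => h.2).to_subtype
  rw [← Nat.card_congr (Equiv.sigmaFiberEquiv fun κ : {κ : V → Finset ℕ //
    IsProperSetColoring G κ ∧ setColWeight ω κ = d} => colorClasses κ.1), Nat.card_sigma,
    Nat.cast_sum]
  symm
  refine Finset.sum_subset_zero_on_sdiff (Finset.subset_univ _) (fun C hC => ?_) fun C hC => ?_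
  · have hC' : ¬ IsStableSetCover G C := by simpa using hC
    rw [Nat.cast_eq_zero, Nat.card_eq_zero]
    exact Or.inl ⟨fun κ => hC' (κ.2 ▸ isStableSetCover_colorClasses κ.1.2.1)⟩
  · rw [Nat.card_congr (fiberEquiv ω d (Finset.mem_filter.1 hC).2)]
end
end

section
/- Let G be a graph and let v, w be distinct vertices with e = vw not an edge of G. Then each of the five graphs G/e, G∪e, G^1, G^2, and G^⋆ has strictly smaller total stability than G: ts(G/e) ≤ ts(G) − 1, ts(G∪e) < ts(G), ts(G^1) < ts(G), ts(G^2) < ts(G), and ts(G^⋆) < ts(G). Consequently, recursive application of the deletion–contraction relation to any vertex-weighted graph terminates in a sum of Kromatic symmetric functions of vertex-weighted complete graphs. -/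
open scoped Classical

noncomputable section

section DeletionContraction

variable {V : Type*}

/-- `G ∪ e`: the graph `G` with the extra edge `e = vw` added. -/
def addEdge (G : SimpleGraph V) (v w : V) : SimpleGraph V :=
  G ⊔ SimpleGraph.fromRel (fun a b => a = v ∧ b = w)

/-- The contraction `G/e` for `e = vw`: the vertices `v, w` are replaced by a single
new vertex (here `none`), adjacent to all neighbors of `v` and of `w`. -/
def contractVW (G : SimpleGraph V) (v w : V) :
    SimpleGraph (Option {u : V // u ≠ v ∧ u ≠ w}) :=
  SimpleGraph.fromRel (fun a b =>
    (∃ a' b' : {u : V // u ≠ v ∧ u ≠ w}, a = some a' ∧ b = some b' ∧ G.Adj a'.1 b'.1) ∨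
    (a = none ∧ ∃ u : {u : V // u ≠ v ∧ u ≠ w}, b = some u ∧ (G.Adj v u.1 ∨ G.Adj w u.1)))

/-- The weight function `ω/e` on `G/e`: the contracted vertex gets weight `ω v + ω w`. -/
def contractWeight (ω : V → ℕ) (v w : V) : Option {u : V // u ≠ v ∧ u ≠ w} → ℕ :=
  fun o => o.elim (ω v + ω w) (fun a => ω a.1)

/-- `G^1`: the graph with vertex set `V(G)` and edge set
`E(G) ∪ {vw} ∪ {vu : u ∈ N(w)}`. -/
def Gone (G : SimpleGraph V) (v w : V) : SimpleGraph V :=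
  G ⊔ SimpleGraph.fromRel (fun a b => a = v ∧ (b = w ∨ G.Adj w b))

/-- `G^2`: the graph with vertex set `V(G)` and edge set
`E(G) ∪ {vw} ∪ {wu : u ∈ N(v)}`. -/
def Gtwo (G : SimpleGraph V) (v w : V) : SimpleGraph V :=
  G ⊔ SimpleGraph.fromRel (fun a b => a = w ∧ (b = v ∨ G.Adj v b))

/-- `G^⋆`: the graph with vertex set `V(G) ∪ {z⋆}` (the new vertex `z⋆` is `none`) and
edge set `E(G) ∪ {vw, vz⋆, wz⋆} ∪ {z⋆u : u ∈ N(v) ∪ N(w)}`. -/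
def Gstar (G : SimpleGraph V) (v w : V) : SimpleGraph (Option V) :=
  SimpleGraph.fromRel (fun a b =>
    (∃ a' b' : V, a = some a' ∧ b = some b' ∧ (G.Adj a' b' ∨ (a' = v ∧ b' = w))) ∨
    (a = none ∧ ∃ u : V, b = some u ∧ (u = v ∨ u = w ∨ G.Adj v u ∨ G.Adj w u)))

/-- The weight function `ω⋆` on `G^⋆`: the new vertex `z⋆` gets weight `ω v + ω w`. -/
def starWeight (ω : V → ℕ) (v w : V) : Option V → ℕ :=
  fun o => o.elim (ω v + ω w) ω

end DeletionContraction

/-- The collection `SSS(G)` of all stable sets of `G` (including the empty set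
and all singletons). -/
def stableSets {V : Type*} [Fintype V] (G : SimpleGraph V) : Finset (Finset V) :=
  Finset.univ.filter (fun S => ∀ a ∈ S, ∀ b ∈ S, ¬ G.Adj a b)

/-- The total stability `ts(G) = |SSS(G)| - |V(G)|`. -/
def totalStability {V : Type*} [Fintype V] (G : SimpleGraph V) : ℤ :=
  (stableSets G).card - Fintype.card V

theorem mem_stableSets {V : Type*} [Fintype V] {G : SimpleGraph V} {S : Finset V} :
    S ∈ stableSets G ↔ ∀ a ∈ S, ∀ b ∈ S, ¬ G.Adj a b := by
  simp [stableSets]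

/-- Adding edges to a graph, at least one of which is new, lowers the total stability. -/
theorem totalStability_lt_of_lt {V : Type*} [Fintype V] {G H : SimpleGraph V} (h : G < H) :
    totalStability H < totalStability G := by
  obtain ⟨v, w, hH, hG⟩ : ∃ v w, H.Adj v w ∧ ¬ G.Adj v w := by
    by_contra! hc
    exact h.not_ge fun a b => hc a b
  have hlt : (stableSets H).card < (stableSets G).card := by
    refine Finset.card_lt_card (Finset.ssubset_iff_of_subset ?_ |>.2 ⟨{v, w}, ?_, ?_⟩)
    · intro S hS
      rw [mem_stableSets] at hS ⊢
      exact fun a ha b hb hab => hS a ha b hb (h.le hab)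
    · rw [mem_stableSets]
      have hG' : ¬ G.Adj w v := fun h' => hG h'.symm
      simp [hG, hG']
    · rw [mem_stableSets]
      exact fun hS => hS v (by simp) w (by simp) hH
  unfold totalStability
  omega

/-- The set of vertices of `G` obtained from a set of vertices of `G/e` by expanding the
contracted vertex to `v` and `w`. -/
def expandContract {V : Type*} [Fintype V] (v w : V)
    (S : Finset (Option {u : V // u ≠ v ∧ u ≠ w})) : Finset V :=
  Finset.univ.filter fun u =>
    (∃ h : u ≠ v ∧ u ≠ w, some ⟨u, h⟩ ∈ S) ∨ (none ∈ S ∧ (u = v ∨ u = w))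

theorem left_mem_expandContract {V : Type*} [Fintype V] {v w : V}
    {S : Finset (Option {u : V // u ≠ v ∧ u ≠ w})} : v ∈ expandContract v w S ↔ none ∈ S := by
  simp [expandContract]

theorem right_mem_expandContract {V : Type*} [Fintype V] {v w : V}
    {S : Finset (Option {u : V // u ≠ v ∧ u ≠ w})} : w ∈ expandContract v w S ↔ none ∈ S := by
  simp [expandContract]

theorem expandContract_injective {V : Type*} [Fintype V] (v w : V) :
    Function.Injective (expandContract v w) := by
  intro S T h
  ext (_ | ⟨u, hu⟩)
  · rw [← left_mem_expandContract, h, left_mem_expandContract]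
  · have := congrArg (u ∈ ·) h
    simpa [expandContract, hu.1, hu.2] using this

theorem expandContract_mem_stableSets {V : Type*} [Fintype V] {G : SimpleGraph V} {v w : V}
    (hnadj : ¬ G.Adj v w) {S : Finset (Option {u : V // u ≠ v ∧ u ≠ w})}
    (hS : S ∈ stableSets (contractVW G v w)) : expandContract v w S ∈ stableSets G := by
  rw [mem_stableSets] at hS ⊢
  have key : ∀ (b : V) (hb : b ≠ v ∧ b ≠ w), some ⟨b, hb⟩ ∈ S → none ∈ S →
      ¬ G.Adj v b ∧ ¬ G.Adj w b := by
    intro b hb hbS hn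
    have := hS none hn _ hbS
    simpa [contractVW, hb.1, hb.2] using this
  have hnadj' : ¬ G.Adj w v := fun h => hnadj h.symm
  intro a ha b hb hab
  simp only [expandContract, Finset.mem_filter, Finset.mem_univ, true_and] at ha hb
  rcases ha with ⟨ha, haS⟩ | ⟨hn, ha⟩ <;> rcases hb with ⟨hb, hbS⟩ | ⟨hn', hb⟩
  · refine hS _ haS _ hbS ?_
    simp [contractVW, hab, hab.ne, ha, hb]
  · have := key a ha haS hn'
    rcases hb with rfl | rfl
    · exact this.1 hab.symm
    · exact this.2 hab.symm
  · have := key b hb hbS hn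
    rcases ha with rfl | rfl
    · exact this.1 hab
    · exact this.2 hab
  · rcases ha with rfl | rfl <;> rcases hb with rfl | rfl <;> simp_all

theorem card_option_ne_and_ne {V : Type*} [Fintype V] {v w : V} (hvw : v ≠ w) :
    Fintype.card (Option {u : V // u ≠ v ∧ u ≠ w}) + 1 = Fintype.card V := by
  have h1 : (Finset.univ.filter fun u : V => u ≠ v ∧ u ≠ w) = Finset.univ \ {v, w} := by
    ext u
    simp
  have h2 := Finset.card_sdiff_add_card_eq_card (Finset.subset_univ ({v, w} : Finset V))
  rw [Finset.card_pair hvw, Finset.card_univ] at h2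
  rw [Fintype.card_option, Fintype.card_subtype, h1]
  omega

theorem totalStability_contractVW_le {V : Type*} [Fintype V] (G : SimpleGraph V) {v w : V}
    (hvw : v ≠ w) (hnadj : ¬ G.Adj v w) :
    totalStability (contractVW G v w) ≤ totalStability G - 1 := by
  have hsub : (stableSets (contractVW G v w)).image (expandContract v w) ⊆
      stableSets G \ {{v}, {w}} := by
    intro T hT
    obtain ⟨S, hS, rfl⟩ := Finset.mem_image.1 hT
    have hiff : v ∈ expandContract v w S ↔ w ∈ expandContract v w S := by
      rw [left_mem_expandContract, right_mem_expandContract]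
    refine Finset.mem_sdiff.2 ⟨expandContract_mem_stableSets hnadj hS, fun h => ?_⟩
    simp only [Finset.mem_insert, Finset.mem_singleton] at h
    rcases h with h | h <;> rw [h] at hiff <;> simp [hvw, hvw.symm] at hiff
  have hpair : ({{v}, {w}} : Finset (Finset V)) ⊆ stableSets G := by
    intro T hT
    simp only [Finset.mem_insert, Finset.mem_singleton] at hT
    rw [mem_stableSets]
    rcases hT with rfl | rfl <;> simp
  have h1 := Finset.card_le_card hsub
  rw [Finset.card_image_of_injective _ (expandContract_injective v w)] at h1
  have h2 := Finset.card_sdiff_add_card_eq_card hpair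
  rw [Finset.card_pair (by simpa using hvw)] at h2
  have h3 := card_option_ne_and_ne hvw
  unfold totalStability
  omega

/-- The set of vertices of `G` obtained from a set of vertices of `G^⋆` by replacing the new
vertex by `v` and `w`. -/
def expandStar {V : Type*} [Fintype V] (v w : V) (S : Finset (Option V)) : Finset V :=
  Finset.univ.filter fun u => some u ∈ S ∨ (none ∈ S ∧ (u = v ∨ u = w))

theorem expandStar_mem_stableSets {V : Type*} [Fintype V] {G : SimpleGraph V} {v w : V}
    (hnadj : ¬ G.Adj v w) {S : Finset (Option V)}
    (hS : S ∈ stableSets (Gstar G v w)) : expandStar v w S ∈ stableSets G := by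
  rw [mem_stableSets] at hS ⊢
  have key : ∀ b : V, some b ∈ S → none ∈ S → ¬ G.Adj v b ∧ ¬ G.Adj w b := by
    intro b hbS hn
    have := hS none hn _ hbS
    simp [Gstar] at this
    tauto
  have hnadj' : ¬ G.Adj w v := fun h => hnadj h.symm
  intro a ha b hb hab
  simp only [expandStar, Finset.mem_filter, Finset.mem_univ, true_and] at ha hb
  rcases ha with haS | ⟨hn, ha⟩ <;> rcases hb with hbS | ⟨hn', hb⟩
  · refine hS _ haS _ hbS ?_
    simp [Gstar, hab, hab.ne]
  · have := key a haS hn'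
    rcases hb with rfl | rfl
    · exact this.1 hab.symm
    · exact this.2 hab.symm
  · have := key b hbS hn
    rcases ha with rfl | rfl
    · exact this.1 hab
    · exact this.2 hab
  · rcases ha with rfl | rfl <;> rcases hb with rfl | rfl <;> simp_all

theorem none_mem_iff_of_mem_stableSets_Gstar {V : Type*} [Fintype V] {G : SimpleGraph V}
    {v w : V} (hvw : v ≠ w) {S : Finset (Option V)} (hS : S ∈ stableSets (Gstar G v w)) :
    none ∈ S ↔ v ∈ expandStar v w S ∧ w ∈ expandStar v w S := by
  rw [mem_stableSets] at hS
  have h : some v ∈ S → some w ∉ S := fun h1 h2 =>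
    hS _ h1 _ h2 (by simp [Gstar, hvw])
  simp only [expandStar, Finset.mem_filter, Finset.mem_univ, true_and, true_or, or_true]
  tauto

theorem some_mem_iff_of_mem_stableSets_Gstar {V : Type*} [Fintype V] {G : SimpleGraph V}
    {v w : V} {S : Finset (Option V)} (hS : S ∈ stableSets (Gstar G v w)) (u : V) :
    some u ∈ S ↔ u ∈ expandStar v w S ∧ ¬ (none ∈ S ∧ (u = v ∨ u = w)) := by
  rw [mem_stableSets] at hS
  have h : none ∈ S → some u ∈ S → ¬ (u = v ∨ u = w) := fun h1 h2 h3 =>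
    hS _ h1 _ h2 (by simp [Gstar]; tauto)
  simp only [expandStar, Finset.mem_filter, Finset.mem_univ, true_and]
  tauto

theorem expandStar_injOn {V : Type*} [Fintype V] (G : SimpleGraph V) {v w : V} (hvw : v ≠ w) :
    Set.InjOn (expandStar v w) (stableSets (Gstar G v w)) := by
  intro S hS T hT h
  have hn : none ∈ S ↔ none ∈ T := by
    rw [none_mem_iff_of_mem_stableSets_Gstar hvw hS, h,
      ← none_mem_iff_of_mem_stableSets_Gstar hvw hT]
  ext (_ | u)
  · exact hn
  · rw [some_mem_iff_of_mem_stableSets_Gstar hS, some_mem_iff_of_mem_stableSets_Gstar hT, h, hn]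

theorem totalStability_Gstar_lt {V : Type*} [Fintype V] (G : SimpleGraph V) {v w : V}
    (hvw : v ≠ w) (hnadj : ¬ G.Adj v w) :
    totalStability (Gstar G v w) < totalStability G := by
  have h := Finset.card_le_card_of_injOn (expandStar v w)
    (fun S hS => expandStar_mem_stableSets hnadj hS) (expandStar_injOn G hvw)
  unfold totalStability
  rw [Fintype.card_option]
  omega

/-- Each of the five graphs appearing in the deletion–contraction relation has
strictly smaller total stability than `G`; in particular the recursion terminates
(at complete graphs). -/
theorem totalStability_decreases {V : Type*} [Fintype V]
    (G : SimpleGraph V) (v w : V) (hvw : v ≠ w) (hnadj : ¬ G.Adj v w) :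
    totalStability (contractVW G v w) ≤ totalStability G - 1 ∧
    totalStability (addEdge G v w) < totalStability G ∧
    totalStability (Gone G v w) < totalStability G ∧
    totalStability (Gtwo G v w) < totalStability G ∧
    totalStability (Gstar G v w) < totalStability G := by
  have lt_of_adj {H : SimpleGraph V} (hle : G ≤ H) (hH : H.Adj v w) : G < H :=
    lt_of_le_not_ge hle fun h => hnadj (h hH)
  refine ⟨totalStability_contractVW_le G hvw hnadj,
    totalStability_lt_of_lt (lt_of_adj le_sup_left ?_),
    totalStability_lt_of_lt (lt_of_adj le_sup_left ?_),
    totalStability_lt_of_lt (lt_of_adj le_sup_left ?_),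
    totalStability_Gstar_lt G hvw hnadj⟩ <;>
  simp [addEdge, Gone, Gtwo, hvw]
end
end
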